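/- Let R = {±(e_i − e_j) : 1 ≤ i < j ≤ 3} ∪ {±(2e_i − e_j − e_k) : {i,j,k} = {1,2,3}} ⊂ ℝ³ (a root system of type G_2, with e_1, e_2, e_3 the standard basis) and β = e_2 + e_3 − 2e_1 (a long root). Then q(β) = 4: the sequence (e_1 − e_2, e_1 − e_2, e_1 − e_2, e_1 + e_2 − 2e_3) is admissible for β, and there is no admissible sequence of length 5. -/

import Mathlib

/-- `α` is an admissible sequence for `β`: each `αᵢ ∈ R`, `αᵢ + αⱼ ∉ R ∪ {0}` for
`i ≠ j`, and `β` plus any nonempty subset-sum of the `αᵢ` lies in `R`. -/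
def IsAdmissible {V : Type*} [AddCommGroup V] (R : Set V) (β : V) {k : ℕ}
    (α : Fin k → V) : Prop :=
  (∀ i, α i ∈ R) ∧
    (∀ i j : Fin k, i ≠ j → α i + α j ∉ R ∧ α i + α j ≠ 0) ∧
    ∀ s : Finset (Fin k), s.Nonempty → β + ∑ i ∈ s, α i ∈ R

/-- The standard basis vector `eᵢ` of `ℝ³`. -/
noncomputable def e (i : Fin 3) : EuclideanSpace ℝ (Fin 3) := EuclideanSpace.single i 1

/-- The root system of type `G₂`:
`{±(eᵢ − eⱼ) : 1 ≤ i < j ≤ 3} ∪ {±(2eᵢ − eⱼ − eₖ) : {i,j,k} = {1,2,3}}`. -/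
def RootG2 : Set (EuclideanSpace ℝ (Fin 3)) :=
  {v | (∃ i j : Fin 3, i ≠ j ∧ v = e i - e j) ∨
    ∃ i j k : Fin 3, i ≠ j ∧ i ≠ k ∧ j ≠ k ∧
      (v = (2 : ℝ) • e i - e j - e k ∨ v = -((2 : ℝ) • e i - e j - e k))}

theorem e_sub_e_mem_rootG2 {i j : Fin 3} (h : i ≠ j) : e i - e j ∈ RootG2 :=
  Or.inl ⟨i, j, h, rfl⟩

theorem two_smul_sub_mem_rootG2 {i j k : Fin 3} (hij : i ≠ j) (hik : i ≠ k) (hjk : j ≠ k) :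
    (2 : ℝ) • e i - e j - e k ∈ RootG2 :=
  Or.inr ⟨i, j, k, hij, hik, hjk, Or.inl rfl⟩

theorem neg_two_smul_sub_mem_rootG2 {i j k : Fin 3} (hij : i ≠ j) (hik : i ≠ k) (hjk : j ≠ k) :
    -((2 : ℝ) • e i - e j - e k) ∈ RootG2 :=
  Or.inr ⟨i, j, k, hij, hik, hjk, Or.inr rfl⟩

/-- Constraints on the first two coordinates of a root. -/
theorem coord_of_mem_rootG2 {v : EuclideanSpace ℝ (Fin 3)} (hv : v ∈ RootG2) :
    v 0 = 1 ∨ v 0 = -1 ∨ (v 0 = 2 ∧ v 1 = -1) ∨ (v 0 = -2 ∧ v 1 = 1) ∨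
      (v 0 = 0 ∧ v 1 ≠ 0) := by
  rcases hv with ⟨i, j, hij, rfl⟩ | ⟨i, j, k, hij, hik, hjk, rfl | rfl⟩
  · fin_cases i <;> fin_cases j <;> simp [e] at hij ⊢
  all_goals
    fin_cases i <;> fin_cases j <;> fin_cases k <;> simp [e] at hij hik hjk ⊢

theorem one_le_coord_of_add_mem_rootG2 {v : EuclideanSpace ℝ (Fin 3)} (hv : v ∈ RootG2)
    (h : e 1 + e 2 - (2 : ℝ) • e 0 + v ∈ RootG2) : 1 ≤ v 0 := by
  have h' := coord_of_mem_rootG2 h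
  have hc0 : (e 1 + e 2 - (2 : ℝ) • e 0 + v) 0 = -2 + v 0 := by simp [e]
  have hc1 : (e 1 + e 2 - (2 : ℝ) • e 0 + v) 1 = 1 + v 1 := by simp [e]
  rw [hc0, hc1] at h'
  rcases coord_of_mem_rootG2 hv with h0 | h0 | ⟨h0, -⟩ | ⟨h0, -⟩ | ⟨h0, h1⟩ <;>
    rcases h' with h | h | ⟨h, -⟩ | ⟨h, h2⟩ | ⟨h, -⟩ <;>
    first
    | linarith
    | exact absurd (by linarith) h1

/-- In the root system of type `G₂` the long root `β = e₂ + e₃ − 2e₁` has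
`q(β) = 4`: the sequence `(e₁ − e₂, e₁ − e₂, e₁ − e₂, e₁ + e₂ − 2e₃)` is
admissible for `β`, and there is no admissible sequence of length `5`. -/
theorem g2_q_eq_four :
    IsAdmissible RootG2 (e 1 + e 2 - (2 : ℝ) • e 0)
      ![e 0 - e 1, e 0 - e 1, e 0 - e 1, e 0 + e 1 - (2 : ℝ) • e 2] ∧
      ¬ ∃ α : Fin 5 → EuclideanSpace ℝ (Fin 3),
        IsAdmissible RootG2 (e 1 + e 2 - (2 : ℝ) • e 0) α := by
  refine ⟨⟨?_, ?_, ?_⟩, ?_⟩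
  · have hshort : e 0 - e 1 ∈ RootG2 := e_sub_e_mem_rootG2 (by decide)
    have hlong : e 0 + e 1 - (2 : ℝ) • e 2 ∈ RootG2 := by
      convert neg_two_smul_sub_mem_rootG2 (i := 2) (j := 0) (k := 1)
        (by decide) (by decide) (by decide) using 1
      module
    intro i
    fin_cases i
    exacts [hshort, hshort, hshort, hlong]
  · intro i j hij
    refine ⟨fun h => ?_, fun h => ?_⟩
    · have h' := coord_of_mem_rootG2 h
      fin_cases i <;> fin_cases j <;> first | exact hij rfl | (simp [e] at h'; norm_num at h')
    · have h' := congrArg (fun v : EuclideanSpace ℝ (Fin 3) => v 0) h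
      fin_cases i <;> fin_cases j <;> first | exact hij rfl | simp [e] at h'
  · intro s _
    have hsum (α : Fin 4 → EuclideanSpace ℝ (Fin 3)) :
        ∑ i ∈ s, α i = ∑ i, if i ∈ s then α i else 0 := by simp
    rw [hsum, Fin.sum_univ_four]
    have h20 := e_sub_e_mem_rootG2 (i := 2) (j := 0) (by decide)
    have h21 := e_sub_e_mem_rootG2 (i := 2) (j := 1) (by decide)
    have h12 := e_sub_e_mem_rootG2 (i := 1) (j := 2) (by decide)
    have h02 := e_sub_e_mem_rootG2 (i := 0) (j := 2) (by decide)
    have hp0 := two_smul_sub_mem_rootG2 (i := 0) (j := 1) (k := 2)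
      (by decide) (by decide) (by decide)
    have hp1 := two_smul_sub_mem_rootG2 (i := 1) (j := 0) (k := 2)
      (by decide) (by decide) (by decide)
    have hn0 := neg_two_smul_sub_mem_rootG2 (i := 0) (j := 1) (k := 2)
      (by decide) (by decide) (by decide)
    have hn1 := neg_two_smul_sub_mem_rootG2 (i := 1) (j := 0) (k := 2)
      (by decide) (by decide) (by decide)
    simp only [Matrix.cons_val]
    split_ifs <;>
    first
    | (convert h20 using 1; module)
    | (convert h21 using 1; module)
    | (convert h12 using 1; module)
    | (convert h02 using 1; module)
    | (convert hp0 using 1; module)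
    | (convert hp1 using 1; module)
    | (convert hn0 using 1; module)
    | (convert hn1 using 1; module)
  · rintro ⟨α, hR, -, hS⟩
    have hα (i : Fin 5) : 1 ≤ α i 0 :=
      one_le_coord_of_add_mem_rootG2 (hR i) (by simpa using hS {i} (by simp))
    have hcoord := coord_of_mem_rootG2 (hS Finset.univ Finset.univ_nonempty)
    have hsum : (e 1 + e 2 - (2 : ℝ) • e 0 + ∑ i, α i) 0 = -2 + ∑ i, α i 0 := by
      simp [e]
    rw [hsum, Fin.sum_univ_five] at hcoord
    have h0 := hα 0
    have h1 := hα 1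
    have h2 := hα 2
    have h3 := hα 3
    have h4 := hα 4
    rcases hcoord with h | h | ⟨h, -⟩ | ⟨h, -⟩ | ⟨h, -⟩ <;> linarith
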